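/- arXiv:0704.2561 — 6 statements merged into one kernel-verified Lean document; each statement's English description precedes it below -/
import Mathlib

section
/- Let V be a ℤ/2-graded vector space over a field k of characteristic zero with a differential d and a bilinear form B of degree δ ∈ {0,1} that is supersymmetric and compatible with d. Suppose s : V → V is an odd linear operator satisfying s² = 0, d∘s + s∘d = id_V, and B(s x, y) = (−1)^{|x|} B(x, s y) for all homogeneous x and all y. Then ker d = im d, the subspace ker d is isotropic, the subspace im s is isotropic, and V = ker d ⊕ im s (an internal direct sum); that is, im s is an isotropic complement to the isotropic subspace ker d = im d. -/
/-- `x` is homogeneous of parity `p` with respect to the grading `V = V0 ⊕ V1`. -/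
def Homog {k V : Type*} [Field k] [AddCommGroup V] [Module k V]
    (V0 V1 : Submodule k V) (p : ZMod 2) (x : V) : Prop :=
  if p = 0 then x ∈ V0 else x ∈ V1

/-- If a square-zero operator `T` has, up to a scalar on each homogeneous element, itself as
an adjoint for `B`, then its range is isotropic. -/
theorem isotropic_range_of_sq_zero {k V : Type*} [Field k] [AddCommGroup V] [Module k V]
    {V0 V1 : Submodule k V} (hgrad : Codisjoint V0 V1) (B : V →ₗ[k] V →ₗ[k] k) (T : V →ₗ[k] V)
    (hT2 : ∀ x, T (T x) = 0) (c : ZMod 2 → k)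
    (hT : ∀ (p : ZMod 2) (x : V), Homog V0 V1 p x → ∀ y : V, B (T x) y = c p * B x (T y)) :
    ∀ x ∈ LinearMap.range T, ∀ y ∈ LinearMap.range T, B x y = 0 := by
  rintro _ ⟨x, rfl⟩ _ ⟨y, rfl⟩
  obtain ⟨a, b, ha, hb, rfl⟩ := Submodule.codisjoint_iff_exists_add_eq.mp hgrad x
  rw [map_add, map_add, LinearMap.add_apply, hT 0 a (by simpa [Homog] using ha),
    hT 1 b (by simpa [Homog] using hb), hT2]
  simp

/-- if `s` is an odd square-zero contracting homotopy for `d`, compatible with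
the degree-`δ` supersymmetric form `B`, then `ker d = im d`, `ker d` and `im s` are isotropic,
and `V = ker d ⊕ im s`. -/
theorem statement0 {k V : Type*} [Field k] [CharZero k] [AddCommGroup V] [Module k V]
    (V0 V1 : Submodule k V) (hgrad : IsCompl V0 V1)
    (δ : ZMod 2)
    (d : V →ₗ[k] V)
    (hd_odd : ∀ (p : ZMod 2) (x : V), Homog V0 V1 p x → Homog V0 V1 (p + 1) (d x))
    (hd2 : ∀ x, d (d x) = 0)
    (B : V →ₗ[k] V →ₗ[k] k)
    (hBdeg : ∀ (p q : ZMod 2) (x y : V), Homog V0 V1 p x → Homog V0 V1 q y →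
      p + q ≠ δ → B x y = 0)
    (hBsym : ∀ (p q : ZMod 2) (x y : V), Homog V0 V1 p x → Homog V0 V1 q y →
      B x y = (-1 : k) ^ (p.val * q.val) * B y x)
    (hBd : ∀ (p : ZMod 2) (x : V), Homog V0 V1 p x → ∀ y : V,
      B (d x) y + (-1 : k) ^ p.val * B x (d y) = 0)
    (s : V →ₗ[k] V)
    (hs_odd : ∀ (p : ZMod 2) (x : V), Homog V0 V1 p x → Homog V0 V1 (p + 1) (s x))
    (hs2 : ∀ x, s (s x) = 0)
    (hhom : ∀ x, d (s x) + s (d x) = x)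
    (hsB : ∀ (p : ZMod 2) (x : V), Homog V0 V1 p x → ∀ y : V,
      B (s x) y = (-1 : k) ^ p.val * B x (s y)) :
    LinearMap.ker d = LinearMap.range d ∧
    (∀ x ∈ LinearMap.ker d, ∀ y ∈ LinearMap.ker d, B x y = 0) ∧
    (∀ x ∈ LinearMap.range s, ∀ y ∈ LinearMap.range s, B x y = 0) ∧
    IsCompl (LinearMap.ker d) (LinearMap.range s) := by
  have hker : LinearMap.ker d = LinearMap.range d := by
    ext x
    refine ⟨fun hx => ⟨s x, ?_⟩, ?_⟩
    · simpa [LinearMap.mem_ker.mp hx] using hhom x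
    · rintro ⟨y, rfl⟩
      exact hd2 y
  refine ⟨hker, ?_, ?_, ?_⟩
  · rw [hker]
    exact isotropic_range_of_sq_zero hgrad.codisjoint B d hd2 (fun p => -(-1) ^ p.val)
      fun p x hx y => by linear_combination hBd p x hx y
  · exact isotropic_range_of_sq_zero hgrad.codisjoint B s hs2 (fun p => (-1) ^ p.val) hsB
  · refine ⟨Submodule.disjoint_def.mpr ?_, Submodule.codisjoint_iff_exists_add_eq.mpr
      fun x => ⟨d (s x), s (d x), hd2 _, ⟨d x, rfl⟩, hhom x⟩⟩
    rintro _ hx ⟨y, rfl⟩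
    simpa [hs2, LinearMap.mem_ker.mp hx] using (hhom (s y)).symm
end

section
/- Let V be a ℤ/2-graded vector space over a field k of characteristic zero with a differential d and a bilinear form B of degree δ ∈ {0,1} that is supersymmetric and compatible with d. Assume ker d = im d, and write U := ker d. Let U′ be an isotropic graded subspace of V with V = U ⊕ U′. Then d restricts to a linear isomorphism from U′ onto U, and the odd linear operator s : V → V defined by s = (d|_{U′})⁻¹ on U and s = 0 on U′ satisfies s² = 0, d∘s + s∘d = id_V, and B(s x, y) = (−1)^{|x|} B(x, s y) for all homogeneous x and all y. -/
/-- An operator `s` inverting an odd operator `d` on a graded subspace `U'` and vanishing on `U'`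
carries `W` into `W'`, where `W` and `W'` are the two homogeneous components. -/
lemma contraction_mem_of_mem {k V : Type*} [Field k] [AddCommGroup V] [Module k V]
    {W W' U' : Submodule k V} (hdisj : Disjoint W W') {d s : V →ₗ[k] V}
    (hd : ∀ x ∈ W, d x ∈ W') (hd' : ∀ x ∈ W', d x ∈ W)
    (hU' : U' ≤ (U' ⊓ W) ⊔ (U' ⊓ W'))
    (hs : ∀ x ∈ U', s x = 0) (hsd : ∀ x ∈ U', s (d x) = x)
    {a b : V} (ha : a ∈ U') (hb : b ∈ U') (hab : d a + b ∈ W) :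
    s (d a + b) ∈ W' := by
  obtain ⟨a₀, ⟨ha₀U, ha₀⟩, a₁, ⟨ha₁U, ha₁⟩, rfl⟩ := Submodule.mem_sup.1 (hU' ha)
  obtain ⟨b₀, ⟨hb₀U, hb₀⟩, b₁, ⟨hb₁U, hb₁⟩, rfl⟩ := Submodule.mem_sup.1 (hU' hb)
  have hW : d a₀ + b₁ ∈ W := by
    have h := W.sub_mem hab (W.add_mem (hd' a₁ ha₁) hb₀)
    rw [map_add] at h
    convert h using 1
    abel
  have hz : d a₀ + b₁ = 0 :=
    Submodule.disjoint_def.1 hdisj _ hW (W'.add_mem (hd a₀ ha₀) hb₁)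
  have ha₀z : a₀ = 0 := by
    have h := congrArg s hz
    rwa [map_add, hsd a₀ ha₀U, hs b₁ hb₁U, add_zero, map_zero] at h
  rw [map_add, hsd _ ha, hs _ hb, ha₀z]
  simpa using ha₁

/-- if `ker d = im d` and `U'` is an isotropic graded complement of
`U := ker d`, then `d` restricts to an isomorphism `U' → U`, and the odd operator `s`
given by `(d|_{U'})⁻¹` on `U` and `0` on `U'` squares to zero, is a contracting homotopy
for `d`, and is compatible with `B`. -/
theorem statement1 {k V : Type*} [Field k] [CharZero k] [AddCommGroup V] [Module k V]
    (V0 V1 : Submodule k V) (hgrad : IsCompl V0 V1)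
    (δ : ZMod 2)
    (d : V →ₗ[k] V)
    (hd_odd : ∀ (p : ZMod 2) (x : V), Homog V0 V1 p x → Homog V0 V1 (p + 1) (d x))
    (hd2 : ∀ x, d (d x) = 0)
    (B : V →ₗ[k] V →ₗ[k] k)
    (hBdeg : ∀ (p q : ZMod 2) (x y : V), Homog V0 V1 p x → Homog V0 V1 q y →
      p + q ≠ δ → B x y = 0)
    (hBsym : ∀ (p q : ZMod 2) (x y : V), Homog V0 V1 p x → Homog V0 V1 q y →
      B x y = (-1 : k) ^ (p.val * q.val) * B y x)
    (hBd : ∀ (p : ZMod 2) (x : V), Homog V0 V1 p x → ∀ y : V,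
      B (d x) y + (-1 : k) ^ p.val * B x (d y) = 0)
    (hker : LinearMap.ker d = LinearMap.range d)
    (U' : Submodule k V)
    (hU'graded : U' = (U' ⊓ V0) ⊔ (U' ⊓ V1))
    (hU'iso : ∀ x ∈ U', ∀ y ∈ U', B x y = 0)
    (hcompl : IsCompl (LinearMap.ker d) U') :
    (∀ x ∈ U', d x ∈ LinearMap.ker d) ∧
    (∀ x ∈ U', d x = 0 → x = 0) ∧
    (∀ u ∈ LinearMap.ker d, ∃ x ∈ U', d x = u) ∧
    ∃ s : V →ₗ[k] V,
      (∀ x ∈ U', s x = 0) ∧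
      (∀ x ∈ U', s (d x) = x) ∧
      (∀ (p : ZMod 2) (x : V), Homog V0 V1 p x → Homog V0 V1 (p + 1) (s x)) ∧
      (∀ x, s (s x) = 0) ∧
      (∀ x, d (s x) + s (d x) = x) ∧
      (∀ (p : ZMod 2) (x : V), Homog V0 V1 p x → ∀ y : V,
        B (s x) y = (-1 : k) ^ p.val * B x (s y)) := by
  have hinj : ∀ x ∈ U', d x = 0 → x = 0 := fun x hx h =>
    Submodule.disjoint_def.1 hcompl.disjoint x h hx
  have hsurj : ∀ u ∈ LinearMap.ker d, ∃ x ∈ U', d x = u := by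
    intro u hu
    rw [hker] at hu
    obtain ⟨z, rfl⟩ := hu
    obtain ⟨a, ha, w, hw, rfl⟩ :=
      Submodule.mem_sup.1 (hcompl.sup_eq_top.ge (Submodule.mem_top (x := z)))
    exact ⟨w, hw, by rw [map_add, LinearMap.mem_ker.1 ha, zero_add]⟩
  refine ⟨fun x _ => hd2 x, hinj, hsurj, ?_⟩
  have hdecomp : ∀ v, ∃ a ∈ U', ∃ b ∈ U', d a + b = v := by
    intro v
    obtain ⟨u, hu, b, hb, rfl⟩ :=
      Submodule.mem_sup.1 (hcompl.sup_eq_top.ge (Submodule.mem_top (x := v)))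
    obtain ⟨a, ha, rfl⟩ := hsurj u hu
    exact ⟨a, ha, b, hb, rfl⟩
  let φ : (U' × U') →ₗ[k] V := (d ∘ₗ U'.subtype).coprod U'.subtype
  have hφ : Function.Bijective φ := by
    constructor
    · rw [injective_iff_map_eq_zero]
      rintro ⟨⟨a, ha⟩, ⟨b, hb⟩⟩ h
      have h' : d a + b = 0 := h
      have ha0 : a = 0 := by
        apply hinj a ha
        have hb' : d b = 0 := by simpa [hd2] using congrArg d h'
        simpa [hinj b hb hb'] using h'
      subst ha0
      have hb0 : b = 0 := by simpa using h'
      subst hb0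
      rfl
    · intro v
      obtain ⟨a, ha, b, hb, rfl⟩ := hdecomp v
      exact ⟨(⟨a, ha⟩, ⟨b, hb⟩), rfl⟩
  let e := LinearEquiv.ofBijective φ hφ
  let s : V →ₗ[k] V := U'.subtype ∘ₗ LinearMap.fst k U' U' ∘ₗ e.symm.toLinearMap
  have hsU' : ∀ x, s x ∈ U' := fun x => (e.symm x).1.2
  have hsab : ∀ a ∈ U', ∀ b ∈ U', s (d a + b) = a := fun a ha b hb =>
    congrArg (fun z : U' × U' => (z.1 : V)) (e.symm_apply_apply (⟨a, ha⟩, ⟨b, hb⟩))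
  have hs0 : ∀ x ∈ U', s x = 0 := fun x hx => by
    simpa using hsab 0 U'.zero_mem x hx
  have hsd : ∀ x ∈ U', s (d x) = x := fun x hx => by
    simpa using hsab x hx 0 U'.zero_mem
  have hhom : ∀ x, d (s x) + s (d x) = x := by
    intro x
    obtain ⟨a, ha, b, hb, rfl⟩ := hdecomp x
    rw [hsab a ha b hb, map_add, hd2, zero_add, hsd b hb]
  have hd01 : ∀ x ∈ V0, d x ∈ V1 := fun x hx => by
    simpa [Homog] using hd_odd 0 x (by simpa [Homog] using hx)
  have hd10 : ∀ x ∈ V1, d x ∈ V0 := fun x hx => by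
    have h := hd_odd 1 x (by simpa [Homog] using hx)
    rwa [show (1 + 1 : ZMod 2) = 0 from rfl, Homog, if_pos rfl] at h
  have hparity : ∀ p : ZMod 2, p = 0 ∨ p = 1 := by decide
  have hs_odd : ∀ (p : ZMod 2) (x : V), Homog V0 V1 p x → Homog V0 V1 (p + 1) (s x) := by
    intro p x hx
    obtain ⟨a, ha, b, hb, rfl⟩ := hdecomp x
    obtain rfl | rfl := hparity p
    · have hx' : d a + b ∈ V0 := by simpa only [Homog, if_pos] using hx
      simpa [Homog] using
        contraction_mem_of_mem hgrad.disjoint hd01 hd10 hU'graded.le hs0 hsd ha hb hx'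
    · rw [Homog, if_neg one_ne_zero] at hx
      rw [show (1 + 1 : ZMod 2) = 0 from rfl, Homog, if_pos rfl]
      exact contraction_mem_of_mem hgrad.symm.disjoint hd10 hd01
        (hU'graded.le.trans (sup_comm _ _).le) hs0 hsd ha hb hx
  refine ⟨s, hs0, hsd, hs_odd, fun x => hs0 _ (hsU' x), hhom, fun p x hx y => ?_⟩
  have hleft : B (s x) y = B (s x) (d (s y)) := by
    conv_lhs => rw [← hhom y]
    rw [map_add, hU'iso _ (hsU' x) _ (hsU' (d y)), add_zero]
  have hright : B x (s y) = B (d (s x)) (s y) := by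
    conv_lhs => rw [← hhom x]
    rw [map_add, LinearMap.add_apply, hU'iso _ (hsU' (d x)) _ (hsU' y), add_zero]
  have hcompat := hBd (p + 1) (s x) (hs_odd p x hx) (s y)
  rw [hleft, hright]
  obtain rfl | rfl := hparity p
  · rw [zero_add, ZMod.val_one, pow_one] at hcompat
    rw [ZMod.val_zero, pow_zero]
    linear_combination -hcompat
  · rw [show (1 + 1 : ZMod 2) = 0 from rfl, ZMod.val_zero, pow_zero] at hcompat
    rw [ZMod.val_one, pow_one]
    linear_combination hcompat
end

section
/- Let V be a finite-dimensional ℤ/2-graded vector space over a field k of characteristic zero with a differential d and a nondegenerate bilinear form B of degree δ ∈ {0,1} that is supersymmetric and compatible with d. If ker d = im d (i.e. V is contractible), then there exists an odd linear operator s : V → V such that s² = 0, d∘s + s∘d = id_V, and B(s x, y) = (−1)^{|x|} B(x, s y) for all homogeneous x and all y. -/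
section ContractingHomotopy

variable {k V : Type*} [Field k] [AddCommGroup V] [Module k V]

/-- The parity operator, equal to `1` on `V0` and to `-1` on `V1`. -/
theorem exists_parity_operator [CharZero k] {V0 V1 : Submodule k V} (hgrad : IsCompl V0 V1) :
    ∃ P : V →ₗ[k] V, (∀ x, P (P x) = x) ∧
      ∀ p x, Homog V0 V1 p x ↔ P x = (-1 : k) ^ p.val • x := by
  let π : V →ₗ[k] V := V0.subtype ∘ₗ V0.projectionOnto V1 hgrad
  have hmem : ∀ x, π x ∈ V0 := fun x => (V0.projectionOnto V1 hgrad x).2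
  have hfix : ∀ x, x ∈ V0 → π x = x := fun x hx => by
    have := Submodule.projectionOnto_apply_left hgrad ⟨x, hx⟩
    exact congrArg Subtype.val this
  have hzero : ∀ x, π x = 0 ↔ x ∈ V1 := fun x => by
    rw [← Submodule.projectionOnto_apply_eq_zero_iff hgrad]
    exact Submodule.coe_eq_zero
  refine ⟨(2 : k) • π - LinearMap.id, fun x => ?_, fun p x => ?_⟩
  · have := hfix _ (hmem x)
    simp only [LinearMap.sub_apply, LinearMap.smul_apply, LinearMap.id_apply, map_sub, map_smul,
      this]
    module
  · have hp : p = 0 ∨ p = 1 := by revert p; decide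
    rcases hp with rfl | rfl
    · have hx : x ∈ V0 ↔ π x = x := ⟨hfix x, fun h => h ▸ hmem x⟩
      simp only [Homog, if_true, hx, LinearMap.sub_apply, LinearMap.smul_apply,
        LinearMap.id_apply, ZMod.val_zero, pow_zero, one_smul]
      refine ⟨fun h => by rw [h]; module, fun h => ?_⟩
      have h2 : (2 : k) • π x = (2 : k) • x := by
        rw [sub_eq_iff_eq_add.mp h]; module
      exact smul_right_injective V (two_ne_zero (α := k)) h2
    · have hval : (1 : ZMod 2).val = 1 := rfl
      simp only [Homog, one_ne_zero, if_false, ← hzero, LinearMap.sub_apply,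
        LinearMap.smul_apply, LinearMap.id_apply, hval, pow_one, neg_smul, one_smul]
      refine ⟨fun h => by rw [h]; module, fun h => ?_⟩
      have h2 : (2 : k) • π x = 0 := by
        rw [sub_eq_iff_eq_add.mp h]; module
      exact (smul_eq_zero.mp h2).resolve_left two_ne_zero

/-- Every element is a sum of an even and an odd one. -/
theorem exists_homog_add {V0 V1 : Submodule k V} (hgrad : IsCompl V0 V1) (x : V) :
    ∃ a b, Homog V0 V1 0 a ∧ Homog V0 V1 1 b ∧ a + b = x := by
  obtain ⟨a, ha, b, hb, h⟩ := Submodule.mem_sup.mp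
    (show x ∈ V0 ⊔ V1 by rw [hgrad.sup_eq_top]; trivial)
  exact ⟨a, b, by simpa [Homog] using ha, by simpa [Homog] using hb, h⟩

/-- An exact differential anticommuting with an involution `P` has a contracting homotopy
anticommuting with `P`. -/
theorem exists_odd_contracting_homotopy [CharZero k] (P d : V →ₗ[k] V)
    (hP : ∀ x, P (P x) = x) (hdP : ∀ x, d (P x) = -P (d x)) (hd2 : ∀ x, d (d x) = 0)
    (hker : LinearMap.ker d = LinearMap.range d) :
    ∃ s : V →ₗ[k] V, (∀ x, s (P x) = -P (s x)) ∧ ∀ x, d (s x) + s (d x) = x := by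
  obtain ⟨g, hg⟩ := d.rangeRestrict.exists_rightInverse_of_surjective d.range_rangeRestrict
  obtain ⟨h, hh⟩ := LinearMap.exists_extend g
  have hdhd : ∀ x, d (h (d x)) = d x := fun x => by
    have h1 : h (d x) = g (d.rangeRestrict x) := LinearMap.congr_fun hh (d.rangeRestrict x)
    rw [h1]
    exact congrArg Subtype.val (LinearMap.congr_fun hg (d.rangeRestrict x))
  let r : V →ₗ[k] V := (2⁻¹ : k) • (h - P ∘ₗ h ∘ₗ P)
  have hr : ∀ x, r x = (2⁻¹ : k) • (h x - P (h (P x))) := fun x => rfl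
  have hrP : ∀ x, r (P x) = -P (r x) := fun x => by
    simp only [hr, map_smul, map_sub, hP]
    module
  have hPd : ∀ x, P (d x) = -d (P x) := fun x => by rw [hdP, neg_neg]
  have hdrd : ∀ x, d (r (d x)) = d x := fun x => by
    have h1 : d (P (h (P (d x)))) = -d x := by
      rw [hPd x, map_neg, hdP, map_neg, map_neg, neg_neg, hdhd, hPd, hP]
    rw [hr, map_smul, map_sub, hdhd, h1]
    module
  refine ⟨r - r ∘ₗ r ∘ₗ d, fun x => ?_, fun x => ?_⟩
  · simp only [LinearMap.sub_apply, LinearMap.comp_apply, hdP, hrP, map_neg, map_sub]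
    module
  · have hx : x - r (d x) ∈ LinearMap.range d := by
      rw [← hker, LinearMap.mem_ker, map_sub, hdrd, sub_self]
    obtain ⟨y, hy⟩ := hx
    have h1 := hdrd y
    rw [hy, map_sub, map_sub] at h1
    simp only [LinearMap.sub_apply, LinearMap.comp_apply, map_sub, hd2, map_zero, sub_zero, h1]
    module

/-- A self-adjoint contracting homotopy `s` gives the square-zero self-adjoint one `s ∘ d ∘ s`. -/
theorem exists_square_zero_homotopy (P d s : V →ₗ[k] V) (B : V →ₗ[k] V →ₗ[k] k)
    (hP : ∀ x, P (P x) = x)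
    (hdP : ∀ x, d (P x) = -P (d x)) (hd2 : ∀ x, d (d x) = 0)
    (hBd : ∀ x y, B (d x) y = -B (P x) (d y))
    (hsP : ∀ x, s (P x) = -P (s x)) (hs : ∀ x, d (s x) + s (d x) = x)
    (hBs : ∀ x y, B (s x) y = B (P x) (s y)) :
    ∃ t : V →ₗ[k] V, (∀ x, t (P x) = -P (t x)) ∧ (∀ x, t (t x) = 0) ∧
      (∀ x, d (t x) + t (d x) = x) ∧ ∀ x y, B (t x) y = B (P x) (t y) := by
  have hds : ∀ x, d (s x) = x - s (d x) := fun x => eq_sub_of_add_eq (hs x)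
  refine ⟨s ∘ₗ d ∘ₗ s, fun x => ?_, fun x => ?_, fun x => ?_, fun x y => ?_⟩
  · simp only [LinearMap.comp_apply, hsP, hdP, map_neg, neg_neg]
  · simp only [LinearMap.comp_apply, hds, map_sub, hd2, map_zero, sub_zero]
    abel
  · simp only [LinearMap.comp_apply, hds, map_sub, hd2, map_zero, sub_zero]
    abel
  · have hPs : ∀ x, P (s x) = -s (P x) := fun x => by rw [hsP, neg_neg]
    have hPd : ∀ x, P (d x) = -d (P x) := fun x => by rw [hdP, neg_neg]
    simp only [LinearMap.comp_apply]
    rw [hBs, hPd, hPs, map_neg d, neg_neg, hBd, hPs, hP, map_neg, LinearMap.neg_apply, neg_neg, hBs]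

/-- A contracting homotopy can be averaged with its adjoint. -/
theorem exists_selfAdjoint_homotopy [CharZero k] [FiniteDimensional k V]
    (P d s : V →ₗ[k] V) (B : V →ₗ[k] V →ₗ[k] k)
    (hP : ∀ x, P (P x) = x) (hdP : ∀ x, d (P x) = -P (d x))
    (hBd : ∀ x y, B (d x) y = -B (P x) (d y))
    (hBnondeg : ∀ v, (∀ u, B v u = 0) → v = 0)
    (hB : (∀ x y, B (P x) y = B x (P y) ∧ B x y = B y (P x)) ∨
      (∀ x y, B (P x) y = -B x (P y) ∧ B x y = B y x))
    (hsP : ∀ x, s (P x) = -P (s x)) (hs : ∀ x, d (s x) + s (d x) = x) :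
    ∃ t : V →ₗ[k] V, (∀ x, t (P x) = -P (t x)) ∧ (∀ x, d (t x) + t (d x) = x) ∧
      ∀ x y, B (t x) y = B (P x) (t y) := by
  have hinj : Function.Injective B := (injective_iff_map_eq_zero B).mpr fun v hv =>
    hBnondeg v fun u => by rw [hv]; rfl
  let e : V ≃ₗ[k] Module.Dual k V :=
    LinearEquiv.ofInjectiveOfFinrankEq B hinj Subspace.dual_finrank_eq.symm
  let t : V →ₗ[k] V := e.symm.toLinearMap ∘ₗ (Module.Dual.transpose s) ∘ₗ B ∘ₗ P
  have ht : ∀ x y, B (t x) y = B (P x) (s y) := fun x y =>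
    LinearMap.congr_fun (e.apply_symm_apply (Module.Dual.transpose s (B (P x)))) y
  have hext : ∀ x y, (∀ u, B x u = B y u) → x = y := fun x y h =>
    hinj (LinearMap.ext h)
  have hPd : ∀ x, P (d x) = -d (P x) := fun x => by rw [hdP, neg_neg]
  have htP : ∀ x, t (P x) = -P (t x) := fun x => hext _ _ fun u => by
    rw [ht, hP, map_neg, LinearMap.neg_apply]
    rcases hB with hB | hB
    · rw [(hB _ _).1, ht, hsP, map_neg, ← (hB _ _).1, hP, neg_neg]
    · rw [(hB _ _).1, ht, hsP, map_neg, neg_neg, ← neg_eq_iff_eq_neg.mpr (hB _ _).1, hP, neg_neg]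
  have htd : ∀ x, d (t x) + t (d x) = x := fun x => hext _ _ fun u => by
    have hPt : P (t x) = -t (P x) := by rw [htP, neg_neg]
    rw [map_add, LinearMap.add_apply, hBd, ht, hPt, hPd, map_neg, map_neg, LinearMap.neg_apply,
      LinearMap.neg_apply, neg_neg, ht, hP, hBd, hP, neg_neg, ← map_add, add_comm, hs]
  have hst : ∀ x y, B (s x) y = B (P x) (t y) := fun x y => by
    have h1 : ∀ u, B y (s u) = B (t (P y)) u := fun u => by rw [ht, hP]
    rcases hB with hB | hB
    · rw [(hB _ _).2, show P (s x) = -s (P x) by rw [hsP, neg_neg], map_neg, h1, (hB _ _).2, htP,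
        map_neg, hP, map_neg, neg_neg]
    · rw [(hB _ _).2, h1, (hB _ _).2, htP, map_neg, (hB (x := x) (y := t y)).1]
  refine ⟨(2⁻¹ : k) • (s + t), fun x => ?_, fun x => ?_, fun x y => ?_⟩
  · simp only [LinearMap.smul_apply, LinearMap.add_apply, hsP, htP, map_smul, map_add]
    module
  · simp only [LinearMap.smul_apply, LinearMap.add_apply, map_smul, map_add]
    rw [← smul_add, add_add_add_comm, hs, htd]
    module
  · simp only [LinearMap.smul_apply, LinearMap.add_apply, map_smul, map_add, hst, ht]
    rw [add_comm]

end ContractingHomotopy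

/-- any finite-dimensional contractible dg vector space with a nondegenerate
supersymmetric inner product of degree `δ` compatible with `d` admits an odd square-zero
contracting homotopy `s` compatible with the inner product. -/
theorem statement2 {k V : Type*} [Field k] [CharZero k] [AddCommGroup V] [Module k V]
    [FiniteDimensional k V]
    (V0 V1 : Submodule k V) (hgrad : IsCompl V0 V1)
    (δ : ZMod 2)
    (d : V →ₗ[k] V)
    (hd_odd : ∀ (p : ZMod 2) (x : V), Homog V0 V1 p x → Homog V0 V1 (p + 1) (d x))
    (hd2 : ∀ x, d (d x) = 0)
    (B : V →ₗ[k] V →ₗ[k] k)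
    (hBdeg : ∀ (p q : ZMod 2) (x y : V), Homog V0 V1 p x → Homog V0 V1 q y →
      p + q ≠ δ → B x y = 0)
    (hBsym : ∀ (p q : ZMod 2) (x y : V), Homog V0 V1 p x → Homog V0 V1 q y →
      B x y = (-1 : k) ^ (p.val * q.val) * B y x)
    (hBd : ∀ (p : ZMod 2) (x : V), Homog V0 V1 p x → ∀ y : V,
      B (d x) y + (-1 : k) ^ p.val * B x (d y) = 0)
    (hBnondeg : ∀ v : V, (∀ u : V, B v u = 0) → v = 0)
    (hker : LinearMap.ker d = LinearMap.range d) :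
    ∃ s : V →ₗ[k] V,
      (∀ (p : ZMod 2) (x : V), Homog V0 V1 p x → Homog V0 V1 (p + 1) (s x)) ∧
      (∀ x, s (s x) = 0) ∧
      (∀ x, d (s x) + s (d x) = x) ∧
      (∀ (p : ZMod 2) (x : V), Homog V0 V1 p x → ∀ y : V,
        B (s x) y = (-1 : k) ^ p.val * B x (s y)) := by
  obtain ⟨P, hP, hPhom⟩ := exists_parity_operator hgrad
  have hval : (1 : ZMod 2).val = 1 := rfl
  have hzmod : ∀ p : ZMod 2, p = 0 ∨ p = 1 := by decide
  have hPe : ∀ x, Homog V0 V1 0 x → P x = x := fun x hx => by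
    simpa using (hPhom 0 x).mp hx
  have hPo : ∀ x, Homog V0 V1 1 x → P x = -x := fun x hx => by
    simpa [hval] using (hPhom 1 x).mp hx
  have hdP : ∀ x, d (P x) = -P (d x) := fun x => by
    obtain ⟨a, b, ha, hb, rfl⟩ := exists_homog_add hgrad x
    have hda := hPo _ (hd_odd 0 a ha)
    have hdb := hPe _ (hd_odd 1 b hb)
    simp only [map_add, hPe a ha, hPo b hb, hda, hdb, map_neg]
    abel
  have hBdP : ∀ x y, B (d x) y = -B (P x) (d y) := fun x y => by
    obtain ⟨a, b, ha, hb, rfl⟩ := exists_homog_add hgrad x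
    have hda := hBd 0 a ha y
    have hdb := hBd 1 b hb y
    simp only [ZMod.val_zero, hval, pow_zero, pow_one] at hda hdb
    simp only [map_add, hPe a ha, hPo b hb, map_neg, LinearMap.add_apply, LinearMap.neg_apply]
    linear_combination hda + hdb
  have hB : (∀ x y, B (P x) y = B x (P y) ∧ B x y = B y (P x)) ∨
      (∀ x y, B (P x) y = -B x (P y) ∧ B x y = B y x) := by
    refine (hzmod δ).imp (fun hδ x y => ?_) (fun hδ x y => ?_) <;> subst hδ <;>
    obtain ⟨a, b, ha, hb, rfl⟩ := exists_homog_add hgrad x <;>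
    obtain ⟨a', b', ha', hb', rfl⟩ := exists_homog_add hgrad y <;>
    have haa := hBsym 0 0 a a' ha ha' <;>
    have hbb := hBsym 1 1 b b' hb hb' <;>
    have hab := hBsym 0 1 a b' ha hb' <;>
    have hba := hBsym 1 0 b a' hb ha' <;>
    simp only [ZMod.val_zero, hval, mul_zero, mul_one, pow_zero, pow_one, one_mul]
      at haa hbb hab hba <;>
    simp only [map_add, hPe a ha, hPo b hb, hPe a' ha', hPo b' hb', map_neg,
      LinearMap.add_apply, LinearMap.neg_apply]
    · have hab0 := hBdeg 0 1 a b' ha hb' (by decide)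
      have hba0 := hBdeg 1 0 b a' hb ha' (by decide)
      constructor
      · linear_combination 2 * hab0 - 2 * hba0
      · linear_combination haa + hbb + hab - hba + 2 * hba0
    · have haa0 := hBdeg 0 0 a a' ha ha' (by decide)
      have hbb0 := hBdeg 1 1 b b' hb hb' (by decide)
      constructor
      · linear_combination 2 * haa0 - 2 * hbb0
      · linear_combination haa - hbb + hab + hba + 2 * hbb0
  obtain ⟨r, hrP, hr⟩ := exists_odd_contracting_homotopy P d hP hdP hd2 hker
  obtain ⟨t, htP, ht, hBt⟩ :=
    exists_selfAdjoint_homotopy P d r B hP hdP hBdP hBnondeg hB hrP hr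
  obtain ⟨s, hsP, hs2, hs, hBs⟩ := exists_square_zero_homotopy P d t B hP hdP hd2 hBdP htP ht hBt
  refine ⟨s, fun p x hx => ?_, hs2, hs, fun p x hx y => ?_⟩
  · have hsign : (-1 : k) ^ (p + 1).val = -(-1) ^ p.val := by
      rcases hzmod p with rfl | rfl
      · simp [hval]
      · simp [hval, show (1 + 1 : ZMod 2) = 0 from rfl]
    rw [hPhom, hsign, neg_smul, ← map_smul, ← (hPhom p x).mp hx, hsP, neg_neg]
  · rw [hBs, (hPhom p x).mp hx, map_smul, LinearMap.smul_apply, smul_eq_mul]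
end

section
/- Let V be a ℤ/2-graded vector space over a field k of characteristic zero with a differential d and a bilinear form B of degree δ ∈ {0,1} that is supersymmetric and compatible with d. Set U := im d, and suppose given graded subspaces W and U′ of V such that ker d = W ⊕ U, V = W ⊕ U ⊕ U′, U′ is isotropic, and B(w, u′) = 0 for all w ∈ W, u′ ∈ U′. Let t : V → V be the projection onto W along U ⊕ U′. Then: (i) d restricts to a linear isomorphism from U′ onto U, so the odd operator s : V → V given by s = (d|_{U′})⁻¹ on U and s = 0 on W ⊕ U′ is well defined; (ii) s² = 0, t² = t, s∘t = t∘s = 0, d∘t = t∘d = 0, and d∘s + s∘d = id_V − t; (iii) B(t x, y) = B(x, t y) for all x, y, and B(s x, y) = (−1)^{|x|} B(x, s y) for all homogeneous x and all y; (iv) the quotient map ker d → H(V) = ker d / im d restricts to a linear isomorphism from W = im t onto H(V). -/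
/-- The homology `H(V) = ker d / im d` of `(V, d)`. -/
abbrev HomologyOf {k V : Type*} [Field k] [AddCommGroup V] [Module k V]
    (d : V →ₗ[k] V) :=
  LinearMap.ker d ⧸ (LinearMap.range d).comap (LinearMap.ker d).subtype

/-- The quotient map `ker d → H(V)`. -/
def homClass {k V : Type*} [Field k] [AddCommGroup V] [Module k V]
    (d : V →ₗ[k] V) : LinearMap.ker d →ₗ[k] HomologyOf d :=
  ((LinearMap.range d).comap (LinearMap.ker d).subtype).mkQ

section Homog

variable {k V : Type*} [Field k] [AddCommGroup V] [Module k V] {V0 V1 : Submodule k V}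

theorem Homog.add {p : ZMod 2} {x y : V} (hx : Homog V0 V1 p x) (hy : Homog V0 V1 p y) :
    Homog V0 V1 p (x + y) := by
  unfold Homog at *
  split_ifs at * <;> exact Submodule.add_mem _ hx hy

theorem Homog.sub {p : ZMod 2} {x y : V} (hx : Homog V0 V1 p x) (hy : Homog V0 V1 p y) :
    Homog V0 V1 p (x - y) := by
  unfold Homog at *
  split_ifs at * <;> exact Submodule.sub_mem _ hx hy

theorem Homog.eq_zero_of_add_one (hdisj : Disjoint V0 V1) {p : ZMod 2} {x : V}
    (hx : Homog V0 V1 p x) (hx' : Homog V0 V1 (p + 1) x) : x = 0 := by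
  rw [Submodule.disjoint_def] at hdisj
  fin_cases p
  · exact hdisj x hx hx'
  · exact hdisj x hx' hx

/-- Every element of a graded subspace splits inside it into a part of parity `p` and a part of
parity `p + 1`. -/
theorem exists_homog_add_of_graded {S : Submodule k V} (hS : S = (S ⊓ V0) ⊔ (S ⊓ V1))
    (p : ZMod 2) {x : V} (hx : x ∈ S) :
    ∃ y ∈ S, ∃ z ∈ S, Homog V0 V1 p y ∧ Homog V0 V1 (p + 1) z ∧ x = y + z := by
  rw [hS] at hx
  obtain ⟨y, hy, z, hz, rfl⟩ := Submodule.mem_sup.1 hx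
  fin_cases p
  · exact ⟨y, hy.1, z, hz.1, hy.2, hz.2, rfl⟩
  · exact ⟨z, hz.1, y, hy.1, hz.2, hy.2, add_comm y z⟩

theorem neg_one_pow_val_mul_self (p : ZMod 2) : (-1 : k) ^ p.val * (-1 : k) ^ p.val = 1 := by
  rw [← mul_pow]
  simp

theorem neg_one_pow_val_add_one (p : ZMod 2) : (-1 : k) ^ (p + 1).val = -(-1 : k) ^ p.val := by
  fin_cases p
  · change (-1 : k) ^ 1 = -(-1 : k) ^ 0
    simp
  · change (-1 : k) ^ 0 = -(-1 : k) ^ 1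
    simp

end Homog

section HodgeDecomposition

variable {k V : Type*} [Field k] [AddCommGroup V] [Module k V] {d : V →ₗ[k] V}
  {W U' : Submodule k V}

theorem exists_mem_map_eq_of_isCompl_ker (hcompl : IsCompl (LinearMap.ker d) U') {u : V}
    (hu : u ∈ LinearMap.range d) : ∃ a ∈ U', d a = u := by
  obtain ⟨v, rfl⟩ := hu
  obtain ⟨c, hc, a, ha, rfl⟩ := Submodule.mem_sup.1
    (hcompl.sup_eq_top ▸ Submodule.mem_top : v ∈ LinearMap.ker d ⊔ U')
  exact ⟨a, ha, by rw [map_add, LinearMap.mem_ker.1 hc, zero_add]⟩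

theorem exists_hodge_decomposition (hkerW : LinearMap.ker d = W ⊔ LinearMap.range d)
    (hcompl : IsCompl (LinearMap.ker d) U') (x : V) :
    ∃ w ∈ W, ∃ a ∈ U', ∃ b ∈ U', x = w + d a + b := by
  obtain ⟨c, hc, b, hb, rfl⟩ := Submodule.mem_sup.1
    (hcompl.sup_eq_top ▸ Submodule.mem_top : x ∈ LinearMap.ker d ⊔ U')
  rw [hkerW] at hc
  obtain ⟨w, hw, u, hu, rfl⟩ := Submodule.mem_sup.1 hc
  obtain ⟨a, ha, rfl⟩ := exists_mem_map_eq_of_isCompl_ker hcompl hu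
  exact ⟨w, hw, a, ha, b, hb, rfl⟩

theorem exists_homog_hodge_decomposition {V0 V1 : Submodule k V} (hdisj : Disjoint V0 V1)
    (hd_odd : ∀ (p : ZMod 2) (x : V), Homog V0 V1 p x → Homog V0 V1 (p + 1) (d x))
    (hW : W = (W ⊓ V0) ⊔ (W ⊓ V1)) (hU' : U' = (U' ⊓ V0) ⊔ (U' ⊓ V1))
    (hkerW : LinearMap.ker d = W ⊔ LinearMap.range d)
    (hcompl : IsCompl (LinearMap.ker d) U') {p : ZMod 2} {x : V} (hx : Homog V0 V1 p x) :
    ∃ w ∈ W, ∃ a ∈ U', ∃ b ∈ U', Homog V0 V1 (p + 1) a ∧ x = w + d a + b := by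
  have hp : p + 1 + 1 = p := by clear hx; revert p; decide
  obtain ⟨w, hw, a, ha, b, hb, hxe⟩ := exists_hodge_decomposition hkerW hcompl x
  obtain ⟨w₀, hw₀, w₁, hw₁, hw₀p, hw₁p, rfl⟩ := exists_homog_add_of_graded hW p hw
  obtain ⟨a₀, ha₀, a₁, ha₁, ha₀p, ha₁p, rfl⟩ := exists_homog_add_of_graded hU' p ha
  obtain ⟨b₀, hb₀, b₁, hb₁, hb₀p, hb₁p, rfl⟩ := exists_homog_add_of_graded hU' p hb
  have hda₁ := hd_odd _ _ ha₁p
  rw [hp] at hda₁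
  have hrest : x - (w₀ + d a₁ + b₀) = w₁ + d a₀ + b₁ := by
    rw [hxe, map_add]; abel
  have hzero : x - (w₀ + d a₁ + b₀) = 0 :=
    (hx.sub ((hw₀p.add hda₁).add hb₀p)).eq_zero_of_add_one hdisj
      (hrest ▸ (hw₁p.add (hd_odd _ _ ha₀p)).add hb₁p)
  exact ⟨w₀, hw₀, a₁, ha₁, b₀, hb₀, ha₁p, sub_eq_zero.1 hzero⟩

/-- The homotopy `s`, inverse to `d` on `range d` and zero on `W ⊕ U'`. -/
theorem exists_hodge_homotopy (hcompl : IsCompl (LinearMap.ker d) U') (hWker : W ≤ LinearMap.ker d)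
    (hd2 : ∀ x, d (d x) = 0) {t : V →ₗ[k] V} (htW : ∀ x ∈ W, t x = x)
    (htU : ∀ x ∈ LinearMap.range d, t x = 0) (htU' : ∀ x ∈ U', t x = 0) :
    ∃ s : V →ₗ[k] V, ∀ w ∈ W, ∀ a ∈ U', ∀ b ∈ U', s (w + d a + b) = a := by
  have hinj : LinearMap.ker (d ∘ₗ U'.subtype) = ⊥ := by
    rw [LinearMap.ker_eq_bot']
    rintro ⟨x, hx⟩ hdx
    exact Subtype.ext (Submodule.disjoint_def.1 hcompl.disjoint x hdx hx)
  obtain ⟨g, hg⟩ := LinearMap.exists_leftInverse_of_injective _ hinj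
  let P : V →ₗ[k] U' := U'.projectionOnto (LinearMap.ker d) hcompl.symm
  refine ⟨U'.subtype ∘ₗ g ∘ₗ (LinearMap.id - t - U'.subtype ∘ₗ P), fun w hw a ha b hb => ?_⟩
  have hP : P (w + d a + b) = ⟨b, hb⟩ := by
    have hker : w + d a ∈ LinearMap.ker d := add_mem (hWker hw) (hd2 a)
    rw [map_add, (Submodule.projectionOnto_apply_eq_zero_iff hcompl.symm).2 hker, zero_add]
    exact Submodule.projectionOnto_apply_left hcompl.symm ⟨b, hb⟩
  have ht : t (w + d a + b) = w := by
    rw [map_add, map_add, htW w hw, htU _ ⟨a, rfl⟩, htU' b hb, add_zero, add_zero]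
  have hga : g (d a) = ⟨a, ha⟩ := LinearMap.congr_fun hg ⟨a, ha⟩
  have hda : w + d a + b - w - b = d a := by abel
  simp [hP, ht, hda, hga]

end HodgeDecomposition

/-- with `U := im d`, a Hodge decomposition `V = W ⊕ U ⊕ U'`
(`ker d = W ⊕ U`, `U'` isotropic and orthogonal to `W`) with `t` the projection onto
`W` along `U ⊕ U'` yields: `d : U' → U` is an isomorphism; the odd operator `s` equal to
`(d|_{U'})⁻¹` on `U` and `0` on `W ⊕ U'` satisfies `s² = 0`, `t² = t`, `st = ts = 0`,
`dt = td = 0`, `ds + sd = id − t`; `t` and `s` are compatible with `B`; and the quotient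
map `ker d → H(V)` restricts to an isomorphism of `W = im t` onto `H(V)`. -/
theorem statement5 {k V : Type*} [Field k] [CharZero k] [AddCommGroup V] [Module k V]
    (V0 V1 : Submodule k V) (hgrad : IsCompl V0 V1)
    (δ : ZMod 2)
    (d : V →ₗ[k] V)
    (hd_odd : ∀ (p : ZMod 2) (x : V), Homog V0 V1 p x → Homog V0 V1 (p + 1) (d x))
    (hd2 : ∀ x, d (d x) = 0)
    (B : V →ₗ[k] V →ₗ[k] k)
    (hBdeg : ∀ (p q : ZMod 2) (x y : V), Homog V0 V1 p x → Homog V0 V1 q y →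
      p + q ≠ δ → B x y = 0)
    (hBsym : ∀ (p q : ZMod 2) (x y : V), Homog V0 V1 p x → Homog V0 V1 q y →
      B x y = (-1 : k) ^ (p.val * q.val) * B y x)
    (hBd : ∀ (p : ZMod 2) (x : V), Homog V0 V1 p x → ∀ y : V,
      B (d x) y + (-1 : k) ^ p.val * B x (d y) = 0)
    (W U' : Submodule k V)
    (hWgraded : W = (W ⊓ V0) ⊔ (W ⊓ V1))
    (hU'graded : U' = (U' ⊓ V0) ⊔ (U' ⊓ V1))
    -- ker d = W ⊕ U  with  U := im d
    (hkerW : LinearMap.ker d = W ⊔ LinearMap.range d)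
    (hWUdisj : Disjoint W (LinearMap.range d))
    -- V = W ⊕ U ⊕ U'
    (hcompl : IsCompl (LinearMap.ker d) U')
    -- U' is isotropic and B(W, U') = 0
    (hU'iso : ∀ x ∈ U', ∀ y ∈ U', B x y = 0)
    (hWU' : ∀ w ∈ W, ∀ u' ∈ U', B w u' = 0)
    -- t is the projection onto W along U ⊕ U'
    (t : V →ₗ[k] V)
    (htW : ∀ x ∈ W, t x = x)
    (htU : ∀ x ∈ LinearMap.range d, t x = 0)
    (htU' : ∀ x ∈ U', t x = 0) :
    -- (i) d restricts to an isomorphism from U' onto U = im d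
    (∀ x ∈ U', d x = 0 → x = 0) ∧
    (∀ u ∈ LinearMap.range d, ∃ x ∈ U', d x = u) ∧
    ∃ s : V →ₗ[k] V,
      -- s is (d|_{U'})⁻¹ on U and 0 on W ⊕ U'
      (∀ x ∈ W, s x = 0) ∧
      (∀ x ∈ U', s x = 0) ∧
      (∀ x ∈ U', s (d x) = x) ∧
      -- s is odd
      (∀ (p : ZMod 2) (x : V), Homog V0 V1 p x → Homog V0 V1 (p + 1) (s x)) ∧
      -- (ii)
      (∀ x, s (s x) = 0) ∧
      (∀ x, t (t x) = t x) ∧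
      (∀ x, s (t x) = 0) ∧
      (∀ x, t (s x) = 0) ∧
      (∀ x, d (t x) = 0) ∧
      (∀ x, t (d x) = 0) ∧
      (∀ x, d (s x) + s (d x) = x - t x) ∧
      -- (iii)
      (∀ x y : V, B (t x) y = B x (t y)) ∧
      (∀ (p : ZMod 2) (x : V), Homog V0 V1 p x → ∀ y : V,
        B (s x) y = (-1 : k) ^ p.val * B x (s y)) ∧
      -- (iv) the quotient map ker d → H(V) restricts to an isomorphism from W onto H(V)
      (∀ (x : V) (hx : x ∈ LinearMap.ker d), x ∈ W → homClass d ⟨x, hx⟩ = 0 → x = 0) ∧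
      (∀ h : HomologyOf d,
        ∃ (x : V) (hx : x ∈ LinearMap.ker d), x ∈ W ∧ homClass d ⟨x, hx⟩ = h) := by
  have hWker : W ≤ LinearMap.ker d := hkerW ▸ le_sup_left
  have hdW : ∀ w ∈ W, d w = 0 := fun w hw => hWker hw
  have hdec := exists_hodge_decomposition hkerW hcompl
  obtain ⟨s, hs⟩ := exists_hodge_homotopy hcompl hWker hd2 htW htU htU'
  have ht : ∀ w ∈ W, ∀ a ∈ U', ∀ b ∈ U', t (w + d a + b) = w := by
    intro w hw a _ b hb
    rw [map_add, map_add, htW w hw, htU _ ⟨a, rfl⟩, htU' b hb, add_zero, add_zero]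
  have hsW : ∀ x ∈ W, s x = 0 := fun x hx => by
    simpa using hs x hx 0 U'.zero_mem 0 U'.zero_mem
  have hsU' : ∀ x ∈ U', s x = 0 := fun x hx => by
    simpa using hs 0 W.zero_mem 0 U'.zero_mem x hx
  have hsd : ∀ x ∈ U', s (d x) = x := fun x hx => by
    simpa using hs 0 W.zero_mem x hx 0 U'.zero_mem
  have hBU'W : ∀ a ∈ U', ∀ w ∈ W, B a w = 0 := by
    intro a ha w hw
    obtain ⟨a₀, ha₀, a₁, ha₁, ha₀p, ha₁p, rfl⟩ := exists_homog_add_of_graded hU'graded 0 ha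
    obtain ⟨w₀, hw₀, w₁, hw₁, hw₀p, hw₁p, rfl⟩ := exists_homog_add_of_graded hWgraded 0 hw
    simp only [map_add, LinearMap.add_apply]
    rw [hBsym _ _ _ _ ha₀p hw₀p, hBsym _ _ _ _ ha₀p hw₁p, hBsym _ _ _ _ ha₁p hw₀p,
      hBsym _ _ _ _ ha₁p hw₁p, hWU' _ hw₀ _ ha₀, hWU' _ hw₀ _ ha₁, hWU' _ hw₁ _ ha₀,
      hWU' _ hw₁ _ ha₁]
    simp
  have hBWd : ∀ w ∈ W, ∀ y, B w (d y) = 0 := by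
    have key : ∀ p w, w ∈ W → Homog V0 V1 p w → ∀ y, B w (d y) = 0 := by
      intro p w hw hwp y
      have h := hBd p w hwp y
      rw [hdW w hw, map_zero, LinearMap.zero_apply, zero_add] at h
      exact (mul_eq_zero.1 h).resolve_left (pow_ne_zero _ (neg_ne_zero.2 one_ne_zero))
    intro w hw y
    obtain ⟨w₀, hw₀, w₁, hw₁, hw₀p, hw₁p, rfl⟩ := exists_homog_add_of_graded hWgraded 0 hw
    rw [map_add, LinearMap.add_apply, key _ _ hw₀ hw₀p, key _ _ hw₁ hw₁p, add_zero]
  have hBdW : ∀ a ∈ U', ∀ w ∈ W, B (d a) w = 0 := by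
    have key : ∀ p x, Homog V0 V1 p x → ∀ w ∈ W, B (d x) w = 0 := by
      intro p x hxp w hw
      simpa [hdW w hw] using hBd p x hxp w
    intro a ha w hw
    obtain ⟨a₀, -, a₁, -, ha₀p, ha₁p, rfl⟩ := exists_homog_add_of_graded hU'graded 0 ha
    rw [map_add, map_add, LinearMap.add_apply, key _ _ ha₀p w hw, key _ _ ha₁p w hw, add_zero]
  refine ⟨fun x hx hdx => Submodule.disjoint_def.1 hcompl.disjoint x hdx hx,
    fun u hu => exists_mem_map_eq_of_isCompl_ker hcompl hu,
    s, hsW, hsU', hsd, ?_, ?_, ?_, ?_, ?_, ?_, ?_, ?_, ?_, ?_, ?_, ?_⟩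
  · intro p x hx
    obtain ⟨w, hw, a, ha, b, hb, hap, rfl⟩ := exists_homog_hodge_decomposition hgrad.disjoint
      hd_odd hWgraded hU'graded hkerW hcompl hx
    rwa [hs w hw a ha b hb]
  · intro x
    obtain ⟨w, hw, a, ha, b, hb, rfl⟩ := hdec x
    rw [hs w hw a ha b hb, hsU' a ha]
  · intro x
    obtain ⟨w, hw, a, ha, b, hb, rfl⟩ := hdec x
    rw [ht w hw a ha b hb, htW w hw]
  · intro x
    obtain ⟨w, hw, a, ha, b, hb, rfl⟩ := hdec x
    rw [ht w hw a ha b hb, hsW w hw]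
  · intro x
    obtain ⟨w, hw, a, ha, b, hb, rfl⟩ := hdec x
    rw [hs w hw a ha b hb, htU' a ha]
  · intro x
    obtain ⟨w, hw, a, ha, b, hb, rfl⟩ := hdec x
    rw [ht w hw a ha b hb, hdW w hw]
  · exact fun x => htU _ ⟨x, rfl⟩
  · intro x
    obtain ⟨w, hw, a, ha, b, hb, rfl⟩ := hdec x
    rw [hs w hw a ha b hb, ht w hw a ha b hb, map_add d, map_add d, hdW w hw, hd2, zero_add,
      zero_add, hsd b hb]
    abel
  · intro x y
    obtain ⟨w, hw, a, ha, b, hb, rfl⟩ := hdec x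
    obtain ⟨w', hw', a', ha', b', hb', rfl⟩ := hdec y
    rw [ht w hw a ha b hb, ht w' hw' a' ha' b' hb']
    simp [hBWd w hw, hWU' w hw b' hb', hBdW a ha w' hw', hBU'W b hb w' hw']
  · intro p x hx y
    obtain ⟨w, hw, a, ha, b, hb, hap, rfl⟩ := exists_homog_hodge_decomposition hgrad.disjoint
      hd_odd hWgraded hU'graded hkerW hcompl hx
    obtain ⟨w', hw', a', ha', b', hb', rfl⟩ := hdec y
    rw [hs w hw a ha b hb, hs w' hw' a' ha' b' hb']
    have h := hBd _ a hap a'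
    rw [neg_one_pow_val_add_one] at h
    simp only [map_add, LinearMap.add_apply, hBU'W a ha w' hw', hU'iso a ha b' hb',
      hWU' w hw a' ha', hU'iso b hb a' ha', zero_add, add_zero]
    linear_combination (-(-1 : k) ^ p.val) * h -
      B a (d a') * neg_one_pow_val_mul_self (k := k) p
  · intro x hx hxW h
    have hxU : (⟨x, hx⟩ : LinearMap.ker d) ∈
        (LinearMap.range d).comap (LinearMap.ker d).subtype :=
      (Submodule.Quotient.mk_eq_zero _).1 h
    exact Submodule.disjoint_def.1 hWUdisj x hxW hxU
  · intro h
    obtain ⟨⟨x, hx⟩, rfl⟩ := Submodule.mkQ_surjective _ h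
    obtain ⟨w, hw, u, hu, rfl⟩ := Submodule.mem_sup.1 (hkerW ▸ hx)
    refine ⟨w, hWker hw, hw, (Submodule.Quotient.eq _).2 ?_⟩
    change w - (w + u) ∈ LinearMap.range d
    rw [sub_add_cancel_left]
    exact neg_mem hu
end

section
/- Let V be a finite-dimensional ℤ/2-graded vector space over a field k of characteristic zero with a differential d and a nondegenerate bilinear form B of degree δ ∈ {0,1} that is supersymmetric and compatible with d. Let W be any graded subspace with ker d = W ⊕ im d. Then: (i) the restriction of B to W is nondegenerate; (ii) V = W ⊕ W^⊥; (iii) im d ⊆ W^⊥; and (iv) im d is a Lagrangian subspace of W^⊥, i.e. im d is isotropic and {v ∈ W^⊥ : B(v, u) = 0 for all u ∈ im d} = im d. -/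
/-- The orthogonal complement `U^⊥ = {v : B(v,u) = 0 for all u ∈ U}` of a subspace `U`
with respect to a bilinear form `B`. -/
def Bperp {k V : Type*} [Field k] [AddCommGroup V] [Module k V]
    (B : V →ₗ[k] V →ₗ[k] k) (U : Submodule k V) : Submodule k V where
  carrier := {v | ∀ u ∈ U, B v u = 0}
  add_mem' := by
    intro a b ha hb u hu
    simp [map_add, ha u hu, hb u hu]
  zero_mem' := by
    intro u hu
    simp
  smul_mem' := by
    intro c a ha u hu
    simp [map_smul, ha u hu]

/-- An element orthogonal on the right to a homogeneous element is orthogonal to it on the left. -/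
theorem apply_eq_zero_of_homog_of_flip {k V : Type*} [Field k] [AddCommGroup V] [Module k V]
    {V0 V1 : Submodule k V} (hgrad : IsCompl V0 V1) {δ : ZMod 2} {B : V →ₗ[k] V →ₗ[k] k}
    (hBdeg : ∀ (p q : ZMod 2) (x y : V), Homog V0 V1 p x → Homog V0 V1 q y →
      p + q ≠ δ → B x y = 0)
    (hBsym : ∀ (p q : ZMod 2) (x y : V), Homog V0 V1 p x → Homog V0 V1 q y →
      B x y = (-1 : k) ^ (p.val * q.val) * B y x)
    {q : ZMod 2} {w v : V} (hw : Homog V0 V1 q w) (h : B w v = 0) : B v w = 0 := by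
  obtain ⟨v0, hv0, v1, hv1, rfl⟩ :=
    Submodule.mem_sup.1 (hgrad.sup_eq_top ▸ Submodule.mem_top : v ∈ V0 ⊔ V1)
  have h0 : Homog V0 V1 0 v0 := by simpa [Homog] using hv0
  have h1 : Homog V0 V1 1 v1 := by simpa [Homog] using hv1
  have hs0 : B v0 w = B w v0 := by simpa using hBsym 0 q v0 w h0 hw
  have hs1 := hBsym 1 q v1 w h1 hw
  rw [map_add] at h
  rw [map_add, LinearMap.add_apply, hs0, hs1]
  by_cases hq : q + 0 = δ
  · have hne : q + 1 ≠ δ := by rw [← hq]; simp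
    have hz := hBdeg q 1 w v1 hw h1 hne
    simpa [hz] using h
  · have hz := hBdeg q 0 w v0 hw h0 hq
    rw [hz, zero_add] at h
    simp [hz, h]

/-- For a nondegenerate form, `dim U + dim U^⊥ ≤ dim V`. -/
theorem finrank_add_finrank_Bperp_le {k V : Type*} [Field k] [AddCommGroup V] [Module k V]
    [FiniteDimensional k V] {B : V →ₗ[k] V →ₗ[k] k}
    (hB : ∀ v : V, (∀ u : V, B v u = 0) → v = 0) (U : Submodule k V) :
    Module.finrank k U + Module.finrank k (Bperp B U) ≤ Module.finrank k V := by
  have hinj : Function.Injective B :=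
    (injective_iff_map_eq_zero B).2 fun v hv => hB v fun u => by simp [hv]
  have hle : (Bperp B U).map B ≤ U.dualAnnihilator := by
    rintro _ ⟨v, hv, rfl⟩
    exact (Submodule.mem_dualAnnihilator _).2 hv
  have hfin := Submodule.finrank_mono hle
  rw [← (Submodule.equivMapOfInjective B hinj _).finrank_eq] at hfin
  rw [← Subspace.finrank_add_finrank_dualAnnihilator_eq U]
  exact Nat.add_le_add_left hfin _

/-- A subspace on which `B` is nondegenerate is complemented by its
orthogonal complement. -/
theorem isCompl_Bperp_of_nondegenerate_on {k V : Type*} [Field k] [AddCommGroup V] [Module k V]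
    [FiniteDimensional k V] {B : V →ₗ[k] V →ₗ[k] k} {W : Submodule k V}
    (hW : ∀ v ∈ W, (∀ u ∈ W, B v u = 0) → v = 0) : IsCompl W (Bperp B W) := by
  refine ⟨Submodule.disjoint_def.2 hW, codisjoint_iff.2 (eq_top_iff.2 fun v _ => ?_)⟩
  have hinj : Function.Injective (B.domRestrict₁₂ W W) :=
    (injective_iff_map_eq_zero _).2 fun w hw => Subtype.ext <|
      hW w w.2 fun u hu => LinearMap.congr_fun hw ⟨u, hu⟩
  obtain ⟨w, hw⟩ := (LinearMap.injective_iff_surjective_of_finrank_eq_finrank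
    (Subspace.dual_finrank_eq (K := k) (V := W)).symm).1 hinj ((B v).domRestrict W)
  refine Submodule.mem_sup.2 ⟨w, w.2, v - w, fun u hu => ?_, by abel⟩
  have hwu : B w u = B v u := LinearMap.congr_fun hw ⟨u, hu⟩
  rw [map_sub, LinearMap.sub_apply, hwu, sub_self]

/-- if `W` is a graded complement to `im d` in `ker d`, then `B|_W` is
nondegenerate, `V = W ⊕ W^⊥`, `im d ⊆ W^⊥`, and `im d` is a Lagrangian subspace of
`W^⊥`: it is isotropic and equals its own orthogonal complement taken inside `W^⊥`. -/
theorem statement7 {k V : Type*} [Field k] [CharZero k] [AddCommGroup V] [Module k V]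
    [FiniteDimensional k V]
    (V0 V1 : Submodule k V) (hgrad : IsCompl V0 V1)
    (δ : ZMod 2)
    (d : V →ₗ[k] V)
    (hd_odd : ∀ (p : ZMod 2) (x : V), Homog V0 V1 p x → Homog V0 V1 (p + 1) (d x))
    (hd2 : ∀ x, d (d x) = 0)
    (B : V →ₗ[k] V →ₗ[k] k)
    (hBdeg : ∀ (p q : ZMod 2) (x y : V), Homog V0 V1 p x → Homog V0 V1 q y →
      p + q ≠ δ → B x y = 0)
    (hBsym : ∀ (p q : ZMod 2) (x y : V), Homog V0 V1 p x → Homog V0 V1 q y →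
      B x y = (-1 : k) ^ (p.val * q.val) * B y x)
    (hBd : ∀ (p : ZMod 2) (x : V), Homog V0 V1 p x → ∀ y : V,
      B (d x) y + (-1 : k) ^ p.val * B x (d y) = 0)
    (hBnondeg : ∀ v : V, (∀ u : V, B v u = 0) → v = 0)
    (W : Submodule k V)
    (hWgraded : W = (W ⊓ V0) ⊔ (W ⊓ V1))
    -- ker d = W ⊕ im d
    (hkerW : LinearMap.ker d = W ⊔ LinearMap.range d)
    (hWdisj : Disjoint W (LinearMap.range d)) :
    -- (i) the restriction of B to W is nondegenerate
    (∀ v ∈ W, (∀ u ∈ W, B v u = 0) → v = 0) ∧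
    -- (ii) V = W ⊕ W^⊥
    IsCompl W (Bperp B W) ∧
    -- (iii) im d ⊆ W^⊥
    LinearMap.range d ≤ Bperp B W ∧
    -- (iv) im d is a Lagrangian subspace of W^⊥
    (∀ x ∈ LinearMap.range d, ∀ y ∈ LinearMap.range d, B x y = 0) ∧
    (∀ v ∈ Bperp B W,
      ((∀ u ∈ LinearMap.range d, B v u = 0) ↔ v ∈ LinearMap.range d)) := by
  have hdecomp (x : V) : ∃ x0 x1, Homog V0 V1 0 x0 ∧ Homog V0 V1 1 x1 ∧ x0 + x1 = x := by
    obtain ⟨x0, hx0, x1, hx1, h⟩ :=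
      Submodule.mem_sup.1 (hgrad.sup_eq_top ▸ Submodule.mem_top : x ∈ V0 ⊔ V1)
    exact ⟨x0, x1, by simpa [Homog] using hx0, by simpa [Homog] using hx1, h⟩
  have hd_homog {p : ZMod 2} {x y : V} (hx : Homog V0 V1 p x) (hy : d y = 0) :
      B (d x) y = 0 := by
    simpa [hy] using hBd p x hx y
  have hleft (x y : V) (hy : d y = 0) : B (d x) y = 0 := by
    obtain ⟨x0, x1, h0, h1, rfl⟩ := hdecomp x
    simp [hd_homog h0 hy, hd_homog h1 hy]
  have hright (x y : V) (hy : d y = 0) : B y (d x) = 0 := by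
    obtain ⟨x0, x1, h0, h1, rfl⟩ := hdecomp x
    rw [map_add, map_add,
      apply_eq_zero_of_homog_of_flip hgrad hBdeg hBsym (hd_odd 0 x0 h0) (hd_homog h0 hy),
      apply_eq_zero_of_homog_of_flip hgrad hBdeg hBsym (hd_odd 1 x1 h1) (hd_homog h1 hy),
      add_zero]
  have hWker (w : V) (hw : w ∈ W) : d w = 0 :=
    LinearMap.mem_ker.1 (hkerW ▸ Submodule.mem_sup_left hw)
  have hrange : LinearMap.range d = Bperp B (LinearMap.ker d) := by
    refine Submodule.eq_of_le_of_finrank_le ?_ ?_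
    · rintro _ ⟨x, rfl⟩ y hy
      exact hleft x y hy
    · have hperp := finrank_add_finrank_Bperp_le hBnondeg (LinearMap.ker d)
      have hrank := d.finrank_range_add_finrank_ker
      omega
  have hmem (v : V) (hvW : ∀ u ∈ W, B v u = 0) (hvd : ∀ u ∈ LinearMap.range d, B v u = 0) :
      v ∈ LinearMap.range d := by
    rw [hrange, hkerW]
    intro u hu
    obtain ⟨a, ha, b, hb, rfl⟩ := Submodule.mem_sup.1 hu
    rw [map_add, hvW a ha, hvd b hb, add_zero]
  have hnondeg : ∀ v ∈ W, (∀ u ∈ W, B v u = 0) → v = 0 := by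
    intro v hv hvW
    refine Submodule.disjoint_def.1 hWdisj v hv (hmem v hvW ?_)
    rintro _ ⟨x, rfl⟩
    exact hright x v (hWker v hv)
  have hiso : ∀ x ∈ LinearMap.range d, ∀ y ∈ LinearMap.range d, B x y = 0 := by
    rintro _ ⟨x, rfl⟩ _ ⟨y, rfl⟩
    exact hleft x (d y) (hd2 y)
  refine ⟨hnondeg, isCompl_Bperp_of_nondegenerate_on hnondeg, ?_, hiso,
    fun v hv => ⟨hmem v hv, hiso v⟩⟩
  rintro _ ⟨x, rfl⟩ w hw
  exact hleft x w (hWker w hw)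
end

section
/- Let V be a ℤ/2-graded vector space over a field k of characteristic zero with a differential d and a bilinear form B of degree δ ∈ {0,1} that is supersymmetric and compatible with d, and assume ker d = im d. Then the assignments s ↦ im s and U′ ↦ s_{U′} (where s_{U′} is defined to be (d|_{U′})⁻¹ on ker d and 0 on U′) are mutually inverse bijections between the set of odd linear operators s : V → V satisfying s² = 0, d∘s + s∘d = id_V and B(s x, y) = (−1)^{|x|} B(x, s y) for all homogeneous x and all y, and the set of isotropic graded subspaces U′ of V with V = ker d ⊕ U′. -/
/-- A "good operator": an odd square-zero contracting homotopy `s` for `d` compatible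
with the bilinear form `B`. -/
def GoodOp {k V : Type*} [Field k] [AddCommGroup V] [Module k V]
    (V0 V1 : Submodule k V) (d : V →ₗ[k] V) (B : V →ₗ[k] V →ₗ[k] k)
    (s : V →ₗ[k] V) : Prop :=
  (∀ (p : ZMod 2) (x : V), Homog V0 V1 p x → Homog V0 V1 (p + 1) (s x)) ∧
  (∀ x, s (s x) = 0) ∧
  (∀ x, d (s x) + s (d x) = x) ∧
  (∀ (p : ZMod 2) (x : V), Homog V0 V1 p x → ∀ y : V,
    B (s x) y = (-1 : k) ^ p.val * B x (s y))

/-- A "good subspace": an isotropic graded complement `U'` of `ker d` in `V`. -/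
def GoodSub {k V : Type*} [Field k] [AddCommGroup V] [Module k V]
    (V0 V1 : Submodule k V) (d : V →ₗ[k] V) (B : V →ₗ[k] V →ₗ[k] k)
    (U' : Submodule k V) : Prop :=
  U' = (U' ⊓ V0) ⊔ (U' ⊓ V1) ∧
  (∀ x ∈ U', ∀ y ∈ U', B x y = 0) ∧
  IsCompl (LinearMap.ker d) U'

/-- If `d` exchanges the summands `A` and `C` and is injective on the graded subspace `U`, then an
element `d u + u'` of `A` with `u, u' ∈ U` has `u ∈ C` and `u' ∈ A`. -/
theorem mem_of_map_add_mem {k V : Type*} [Field k] [AddCommGroup V] [Module k V]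
    {A C U : Submodule k V} {d : V →ₗ[k] V} (hAC : Disjoint A C)
    (hA : ∀ x ∈ A, d x ∈ C) (hC : ∀ x ∈ C, d x ∈ A) (hd2 : ∀ x, d (d x) = 0)
    (hU : U = (U ⊓ A) ⊔ (U ⊓ C)) (hdU : Disjoint (LinearMap.ker d) U)
    {u u' : V} (hu : u ∈ U) (hu' : u' ∈ U) (h : d u + u' ∈ A) : u ∈ C ∧ u' ∈ A := by
  rw [hU] at hu hu'
  obtain ⟨a, ⟨haU, haA⟩, c, ⟨-, hcC⟩, rfl⟩ := Submodule.mem_sup.mp hu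
  obtain ⟨a', ⟨-, haA'⟩, c', ⟨hcU', hcC'⟩, rfl⟩ := Submodule.mem_sup.mp hu'
  have hC' : d a + c' ∈ C := C.add_mem (hA a haA) hcC'
  have hA' : d a + c' ∈ A := by
    have h' := A.sub_mem h (A.add_mem (hC c hcC) haA')
    rwa [map_add, show d a + d c + (a' + c') - (d c + a') = d a + c' by abel] at h'
  have hsum : d a + c' = 0 := Submodule.disjoint_def.mp hAC _ hA' hC'
  have hc0 : c' = 0 := by
    refine Submodule.disjoint_def.mp hdU _ ?_ hcU'
    rw [LinearMap.mem_ker]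
    simpa [hd2] using congrArg d hsum
  have ha0 : a = 0 := by
    refine Submodule.disjoint_def.mp hdU _ ?_ haU
    simpa [hc0] using hsum
  rw [ha0, hc0, zero_add, add_zero]
  exact ⟨hcC, haA'⟩

/-- The homogeneous version of `mem_of_map_add_mem`, with the parity as a parameter. -/
theorem Homog.of_map_add {k V : Type*} [Field k] [AddCommGroup V] [Module k V]
    {V0 V1 U : Submodule k V} {d : V →ₗ[k] V} (hgrad : Disjoint V0 V1)
    (hd_odd : ∀ (p : ZMod 2) (x : V), Homog V0 V1 p x → Homog V0 V1 (p + 1) (d x))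
    (hd2 : ∀ x, d (d x) = 0)
    (hU : U = (U ⊓ V0) ⊔ (U ⊓ V1)) (hdU : Disjoint (LinearMap.ker d) U)
    (p : ZMod 2) {u u' : V} (hu : u ∈ U) (hu' : u' ∈ U) (h : Homog V0 V1 p (d u + u')) :
    Homog V0 V1 (p + 1) u := by
  have h0 : ∀ x ∈ V0, d x ∈ V1 := fun x hx => by simpa [Homog] using hd_odd 0 x (by simpa [Homog])
  have h1 : ∀ x ∈ V1, d x ∈ V0 := fun x hx => by
    simpa [Homog, show (1 + 1 : ZMod 2) = 0 from rfl] using hd_odd 1 x (by simpa [Homog])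
  obtain rfl | rfl := (by decide : ∀ q : ZMod 2, q = 0 ∨ q = 1) p
  · simpa [Homog] using
      (mem_of_map_add_mem hgrad h0 h1 hd2 hU hdU hu hu' (by simpa [Homog] using h)).1
  · simpa [Homog, show (1 + 1 : ZMod 2) = 0 from rfl] using
      (mem_of_map_add_mem hgrad.symm h1 h0 hd2 (by rwa [sup_comm]) hdU hu hu'
        (by simpa [Homog] using h)).1

/-- The image of a good operator is a good subspace. -/
theorem GoodOp.goodSub_range {k V : Type*} [Field k] [AddCommGroup V] [Module k V]
    {V0 V1 : Submodule k V} (hgrad : IsCompl V0 V1) {d : V →ₗ[k] V} (hd2 : ∀ x, d (d x) = 0)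
    {B : V →ₗ[k] V →ₗ[k] k} {s : V →ₗ[k] V} (hs : GoodOp V0 V1 d B s) :
    GoodSub V0 V1 d B (LinearMap.range s) := by
  obtain ⟨hodd, hs2, hds, hBs⟩ := hs
  have hdecomp : ∀ x : V, ∃ a ∈ V0, ∃ b ∈ V1, a + b = x := fun x =>
    Submodule.mem_sup.mp (hgrad.sup_eq_top ▸ Submodule.mem_top)
  refine ⟨le_antisymm ?_ (sup_le inf_le_left inf_le_left), ?_, ?_, ?_⟩
  · rintro _ ⟨x, rfl⟩
    obtain ⟨a, ha, b, hb, rfl⟩ := hdecomp x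
    have ha' : s a ∈ V1 := by simpa [Homog] using hodd 0 a (by simpa [Homog])
    have hb' : s b ∈ V0 := by
      simpa [Homog, show (1 + 1 : ZMod 2) = 0 from rfl] using hodd 1 b (by simpa [Homog])
    rw [map_add, add_comm]
    exact Submodule.add_mem_sup ⟨⟨b, rfl⟩, hb'⟩ ⟨⟨a, rfl⟩, ha'⟩
  · rintro _ ⟨x, rfl⟩ _ ⟨y, rfl⟩
    obtain ⟨a, ha, b, hb, rfl⟩ := hdecomp x
    rw [map_add, map_add, LinearMap.add_apply, hBs 0 a (by simpa [Homog]),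
      hBs 1 b (by simpa [Homog]), hs2]
    simp
  · rw [Submodule.disjoint_def]
    rintro _ hx ⟨y, rfl⟩
    rw [LinearMap.mem_ker] at hx
    simpa [hs2, hx] using (hds (s y)).symm
  · rw [codisjoint_iff, eq_top_iff]
    intro x _
    rw [← hds x]
    exact Submodule.add_mem_sup (LinearMap.mem_ker.mpr (hd2 _)) ⟨d x, rfl⟩

/-- A map vanishing on a complement `U` of `ker d` and inverting `d` there exists. -/
theorem exists_inverse_of_isCompl_ker {k V : Type*} [Field k] [AddCommGroup V] [Module k V]
    {d : V →ₗ[k] V} (hd2 : ∀ x, d (d x) = 0) {U : Submodule k V}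
    (hU : IsCompl (LinearMap.ker d) U) :
    ∃ s : V →ₗ[k] V, (∀ x ∈ U, s x = 0) ∧ ∀ x ∈ U, s (d x) = x := by
  have hinj : LinearMap.ker (d ∘ₗ U.subtype) = ⊥ := by
    rw [LinearMap.ker_eq_bot']
    intro u hu
    exact Subtype.ext (Submodule.disjoint_def.mp hU.disjoint _ hu u.2)
  obtain ⟨f, hf⟩ := LinearMap.exists_leftInverse_of_injective _ hinj
  refine ⟨U.subtype ∘ₗ f ∘ₗ (LinearMap.ker d).subtype ∘ₗ
    Submodule.projectionOnto (LinearMap.ker d) U hU, fun x hx => ?_, fun x hx => ?_⟩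
  · simp [(Submodule.projectionOnto_apply_eq_zero_iff hU).mpr hx]
  · have hp := Submodule.projectionOnto_apply_left hU ⟨d x, hd2 x⟩
    have hfx := LinearMap.congr_fun hf ⟨x, hx⟩
    simp only [LinearMap.comp_apply, Submodule.subtype_apply, LinearMap.id_apply] at hp hfx ⊢
    rw [hp, hfx]

/-- If `im d = ker d` and `U` is a complement of `ker d`, then `V = d U + U`. -/
theorem exists_map_add_eq {k V : Type*} [Field k] [AddCommGroup V] [Module k V]
    {d : V →ₗ[k] V} (hker : LinearMap.ker d = LinearMap.range d) {U : Submodule k V}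
    (hU : IsCompl (LinearMap.ker d) U) (x : V) : ∃ u ∈ U, ∃ u' ∈ U, d u + u' = x := by
  have hsum : ∀ y : V, ∃ a ∈ LinearMap.ker d, ∃ b ∈ U, a + b = y := fun y =>
    Submodule.mem_sup.mp (hU.sup_eq_top ▸ Submodule.mem_top)
  obtain ⟨a, ha, u', hu', rfl⟩ := hsum x
  rw [hker] at ha
  obtain ⟨y, rfl⟩ := ha
  obtain ⟨b, hb, u, hu, rfl⟩ := hsum y
  exact ⟨u, hu, u', hu', by simp [LinearMap.mem_ker.mp hb]⟩

/-- under `ker d = im d`, the assignments `s ↦ im s` and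
`U' ↦ s_{U'}` (where `s_{U'}` is `(d|_{U'})⁻¹` on `ker d` and `0` on `U'`) are mutually
inverse bijections between odd square-zero contracting homotopies compatible with `B`
and isotropic graded complements of `ker d`.  Concretely: for each good operator `s`,
`im s` is a good subspace and `s` is recovered as `s_{im s}` (it vanishes on `im s`
and inverts `d` there); for each good subspace `U'` there is a unique linear map
vanishing on `U'` and inverting `d|_{U'}`, it is a good operator and its image is
`U'`. -/
theorem statement9 {k V : Type*} [Field k] [CharZero k] [AddCommGroup V] [Module k V]
    (V0 V1 : Submodule k V) (hgrad : IsCompl V0 V1)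
    (δ : ZMod 2)
    (d : V →ₗ[k] V)
    (hd_odd : ∀ (p : ZMod 2) (x : V), Homog V0 V1 p x → Homog V0 V1 (p + 1) (d x))
    (hd2 : ∀ x, d (d x) = 0)
    (B : V →ₗ[k] V →ₗ[k] k)
    (hBdeg : ∀ (p q : ZMod 2) (x y : V), Homog V0 V1 p x → Homog V0 V1 q y →
      p + q ≠ δ → B x y = 0)
    (hBsym : ∀ (p q : ZMod 2) (x y : V), Homog V0 V1 p x → Homog V0 V1 q y →
      B x y = (-1 : k) ^ (p.val * q.val) * B y x)
    (hBd : ∀ (p : ZMod 2) (x : V), Homog V0 V1 p x → ∀ y : V,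
      B (d x) y + (-1 : k) ^ p.val * B x (d y) = 0)
    (hker : LinearMap.ker d = LinearMap.range d) :
    -- s ↦ im s lands in good subspaces, and s = s_{im s}
    (∀ s : V →ₗ[k] V, GoodOp V0 V1 d B s →
      GoodSub V0 V1 d B (LinearMap.range s) ∧
      (∀ x ∈ LinearMap.range s, s x = 0) ∧
      (∀ x ∈ LinearMap.range s, s (d x) = x)) ∧
    -- U' ↦ s_{U'} is well defined, lands in good operators, and im s_{U'} = U'
    (∀ U' : Submodule k V, GoodSub V0 V1 d B U' →
      ∃ s : V →ₗ[k] V,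
        GoodOp V0 V1 d B s ∧
        (∀ x ∈ U', s x = 0) ∧
        (∀ x ∈ U', s (d x) = x) ∧
        LinearMap.range s = U' ∧
        (∀ s' : V →ₗ[k] V,
          (∀ x ∈ U', s' x = 0) → (∀ x ∈ U', s' (d x) = x) → s' = s)) := by
  refine ⟨fun s hs => ⟨hs.goodSub_range hgrad hd2, ?_, ?_⟩, fun U' hU' => ?_⟩
  · rintro _ ⟨x, rfl⟩
    exact hs.2.1 x
  · rintro _ ⟨x, rfl⟩
    simpa [hs.2.1 x] using hs.2.2.1 (s x)
  obtain ⟨hUgr, hUiso, hUcompl⟩ := hU'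
  obtain ⟨s, hs0, hsd⟩ := exists_inverse_of_isCompl_ker hd2 hUcompl
  have hdec := exists_map_add_eq hker hUcompl
  have hs : ∀ u ∈ U', ∀ u' ∈ U', s (d u + u') = u := fun u hu u' hu' => by
    rw [map_add, hsd u hu, hs0 u' hu', add_zero]
  refine ⟨s, ⟨?_, ?_, ?_, ?_⟩, hs0, hsd, ?_, ?_⟩
  · intro p x hx
    obtain ⟨u, hu, u', hu', rfl⟩ := hdec x
    rw [hs u hu u' hu']
    exact Homog.of_map_add hgrad.disjoint hd_odd hd2 hUgr hUcompl.disjoint p hu hu' hx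
  · intro x
    obtain ⟨u, hu, u', hu', rfl⟩ := hdec x
    rw [hs u hu u' hu', hs0 u hu]
  · intro x
    obtain ⟨u, hu, u', hu', rfl⟩ := hdec x
    rw [hs u hu u' hu', map_add, hd2, zero_add, hsd u' hu']
  · intro p x hx y
    obtain ⟨u, hu, u', hu', rfl⟩ := hdec x
    obtain ⟨w, hw, w', hw', rfl⟩ := hdec y
    have hup := Homog.of_map_add hgrad.disjoint hd_odd hd2 hUgr hUcompl.disjoint p hu hu' hx
    have hB := hBd (p + 1) u hup w
    rw [hs u hu u' hu', hs w hw w' hw', map_add, map_add, LinearMap.add_apply,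
      hUiso u hu w' hw', hUiso u' hu' w hw, add_zero, add_zero]
    obtain rfl | rfl := (by decide : ∀ q : ZMod 2, q = 0 ∨ q = 1) p
    · simp only [zero_add, ZMod.val_zero, ZMod.val_one, pow_zero, pow_one] at hB ⊢
      linear_combination -hB
    · simp only [show (1 + 1 : ZMod 2) = 0 from rfl, ZMod.val_zero, ZMod.val_one, pow_zero,
        pow_one] at hB ⊢
      linear_combination hB
  · apply le_antisymm
    · rintro _ ⟨x, rfl⟩
      obtain ⟨u, hu, u', hu', rfl⟩ := hdec x
      rwa [hs u hu u' hu']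
    · exact fun u hu => ⟨d u, hsd u hu⟩
  · intro s' hs0' hsd'
    ext x
    obtain ⟨u, hu, u', hu', rfl⟩ := hdec x
    rw [hs u hu u' hu', map_add, hsd' u hu, hs0' u' hu', add_zero]
end
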